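/- There exist positive constants l_1, …, l_n and C_1, C_2 > 0 such that V_n is C¹ on ℝ^n ∖ {0}, and for every x ∈ ℝ^n ∖ {0}, every u ∈ ℝ, every D = (d_1, …, d_{n−1}, 0)ᵀ ∈ ℝ^n (i.e., Dᵀe_n = 0), and every s ∈ [−1, 1] with s = sign(ω_n(x)) whenever ω_n(x) ≠ 0, one has ∇V_n(x)·(J_n x + e_n u + D) ≤ −C_1 V_n(x)^α + ω_n(x)(u + l_n s) + C_2 Σ_{i=1}^{n−1} |d_i|^{2p_2/p_{i+1}}. -/

import Mathlib

open MeasureTheory Filter Matrix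

noncomputable section

/-- The signed power `⌊x⌉^a = |x|^a · sign x`. -/
def sgnPow (x a : ℝ) : ℝ := |x| ^ a * Real.sign x

/-- The exponents `p_i = 1 - (i-1)/n`. -/
def pe (n i : ℕ) : ℝ := 1 - ((i : ℝ) - 1) / n

/-- The exponents `β_0 = p_2`, `β_i = (n-1+i)/(n-i)`. -/
def be (n i : ℕ) : ℝ := if i = 0 then pe n 2 else ((n : ℝ) - 1 + i) / ((n : ℝ) - i)

/-- The exponent `α = 2(n-1)/(2n-1)`. -/
def al (n : ℕ) : ℝ := 2 * ((n : ℝ) - 1) / (2 * (n : ℝ) - 1)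

/-- The recursively defined virtual controls `v_i`; states are 1-indexed sequences
(the 0-th coordinate is unused). -/
def vfb (n : ℕ) (l : ℕ → ℝ) : ℕ → (ℕ → ℝ) → ℝ
  | 0, _ => 0
  | i + 1, x =>
    -l (i + 1) *
      sgnPow (sgnPow (x (i + 1)) (be n i) - sgnPow (vfb n l i x) (be n i))
        (pe n (i + 2) / (pe n (i + 1) * be n i))

/-- `ω_i(x_1,…,x_i) = ⌊x_i⌉^{β_{i-1}} - ⌊v_{i-1}⌉^{β_{i-1}}`. -/
def omfb (n : ℕ) (l : ℕ → ℝ) (i : ℕ) (x : ℕ → ℝ) : ℝ :=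
  sgnPow (x i) (be n (i - 1)) - sgnPow (vfb n l (i - 1) x) (be n (i - 1))

/-- `W_i`. -/
def Wfb (n : ℕ) (l : ℕ → ℝ) (i : ℕ) (x : ℕ → ℝ) : ℝ :=
  (|x i| ^ (be n (i - 1) + 1) - |vfb n l (i - 1) x| ^ (be n (i - 1) + 1)) / (be n (i - 1) + 1) -
    sgnPow (vfb n l (i - 1) x) (be n (i - 1)) * (x i - vfb n l (i - 1) x)

/-- Embedding of `ℝ^n` into 1-indexed sequences. -/
def emb (n : ℕ) (x : Fin n → ℝ) (j : ℕ) : ℝ :=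
  if h : 1 ≤ j ∧ j ≤ n then x ⟨j - 1, by omega⟩ else 0

/-- The Lyapunov function `V_n = Σ_{i=1}^n W_i` on `ℝ^n`. -/
def Vn (n : ℕ) (l : ℕ → ℝ) (x : Fin n → ℝ) : ℝ :=
  ∑ i ∈ Finset.Icc 1 n, Wfb n l i (emb n x)

/-- `ω_n` on `ℝ^n`. -/
def omn (n : ℕ) (l : ℕ → ℝ) (x : Fin n → ℝ) : ℝ := omfb n l n (emb n x)

/-- The `n`-th Jordan block: `(J_n)_{ij} = 1` if `i = j - 1` (1-indexed), else `0`. -/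
def Jmat (n : ℕ) : Matrix (Fin n) (Fin n) ℝ :=
  Matrix.of fun i j => if (i : ℕ) + 1 = (j : ℕ) then 1 else 0

/-- The `i`-th standard basis vector of `ℝ^n` (1-indexed: `eVec n n = e_n`). -/
def eVec (n i : ℕ) : Fin n → ℝ := fun j => if (j : ℕ) + 1 = i then 1 else 0

/-! ### Signed powers -/

theorem sgnPow_of_pos {x : ℝ} (hx : 0 < x) (a : ℝ) : sgnPow x a = x ^ a := by
  simp [sgnPow, Real.sign_of_pos hx, abs_of_pos hx]

@[simp]
theorem sgnPow_zero_left (a : ℝ) : sgnPow 0 a = 0 := by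
  simp [sgnPow]

@[simp]
theorem sgnPow_neg (x a : ℝ) : sgnPow (-x) a = -sgnPow x a := by
  simp [sgnPow, Real.sign_neg]

@[simp]
theorem sgnPow_one (x : ℝ) : sgnPow x 1 = x := by
  rcases lt_trichotomy x 0 with hx | rfl | hx
  · simp [sgnPow, Real.sign_of_neg hx, abs_of_neg hx]
  · simp
  · simp [sgnPow_of_pos hx]

theorem sgnPow_of_nonneg {x a : ℝ} (hx : 0 ≤ x) (ha : a ≠ 0) : sgnPow x a = x ^ a := by
  rcases hx.eq_or_lt with rfl | hx
  · simp [Real.zero_rpow ha]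
  · exact sgnPow_of_pos hx a

theorem abs_sgnPow {x a : ℝ} (ha : a ≠ 0) : |sgnPow x a| = |x| ^ a := by
  rcases lt_trichotomy x 0 with hx | rfl | hx
  · obtain ⟨y, rfl⟩ : ∃ y, x = -y := ⟨-x, by simp⟩
    have hy : 0 < y := by linarith
    rw [sgnPow_neg, abs_neg, abs_neg, sgnPow_of_pos hy, abs_of_pos hy,
      abs_of_pos (Real.rpow_pos_of_pos hy _)]
  · simp [Real.zero_rpow ha]
  · rw [sgnPow_of_pos hx, abs_of_pos hx, abs_of_pos (Real.rpow_pos_of_pos hx _)]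

theorem sgnPow_sgnPow (x a b : ℝ) : sgnPow (sgnPow x a) b = sgnPow x (a * b) := by
  rcases lt_trichotomy x 0 with hx | rfl | hx
  · obtain ⟨y, rfl⟩ : ∃ y, x = -y := ⟨-x, by simp⟩
    have hy : 0 < y := by linarith
    simp only [sgnPow_neg]
    rw [sgnPow_of_pos hy, sgnPow_of_pos (Real.rpow_pos_of_pos hy _), sgnPow_of_pos hy,
      Real.rpow_mul hy.le]
  · simp
  · rw [sgnPow_of_pos hx, sgnPow_of_pos (Real.rpow_pos_of_pos hx _), sgnPow_of_pos hx,
      Real.rpow_mul hx.le]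

theorem sgnPow_mul_of_pos {c : ℝ} (hc : 0 < c) (x a : ℝ) :
    sgnPow (c * x) a = c ^ a * sgnPow x a := by
  rcases lt_trichotomy x 0 with hx | rfl | hx
  · obtain ⟨y, rfl⟩ : ∃ y, x = -y := ⟨-x, by simp⟩
    have hy : 0 < y := by linarith
    simp only [sgnPow_neg, mul_neg]
    rw [sgnPow_of_pos hy, sgnPow_of_pos (mul_pos hc hy), Real.mul_rpow hc.le hy.le]
  · simp
  · rw [sgnPow_of_pos hx, sgnPow_of_pos (mul_pos hc hx), Real.mul_rpow hc.le hx.le]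

theorem mul_sgnPow {a : ℝ} (ha : a + 1 ≠ 0) (x : ℝ) : x * sgnPow x a = |x| ^ (a + 1) := by
  rcases lt_trichotomy x 0 with hx | rfl | hx
  · obtain ⟨y, rfl⟩ : ∃ y, x = -y := ⟨-x, by simp⟩
    have hy : 0 < y := by linarith
    rw [sgnPow_neg, sgnPow_of_pos hy, abs_neg, abs_of_pos hy, Real.rpow_add_one hy.ne']
    ring
  · simp [Real.zero_rpow ha]
  · rw [sgnPow_of_pos hx, abs_of_pos hx, Real.rpow_add_one hx.ne']
    ring

theorem sgnPow_eq_abs_rpow_mul (a x : ℝ) :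
    sgnPow x a = |x| ^ (a - 1) * x := by
  rcases lt_trichotomy x 0 with hx | rfl | hx
  · obtain ⟨y, rfl⟩ : ∃ y, x = -y := ⟨-x, by simp⟩
    have hy : 0 < y := by linarith
    rw [sgnPow_neg, sgnPow_of_pos hy, abs_neg, abs_of_pos hy, mul_neg,
      ← Real.rpow_add_one hy.ne', sub_add_cancel]
  · simp
  · rw [sgnPow_of_pos hx, abs_of_pos hx, ← Real.rpow_add_one hx.ne', sub_add_cancel]

theorem continuous_abs_rpow {a : ℝ} (ha : 0 ≤ a) : Continuous fun x : ℝ => |x| ^ a :=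
  continuous_abs.rpow_const fun _ => Or.inr ha

theorem hasDerivAt_sgnPow {a : ℝ} (ha : 1 < a) (x : ℝ) :
    HasDerivAt (fun y => sgnPow y a) (a * |x| ^ (a - 1)) x := by
  have hpos : ∀ y : ℝ, 0 < y → HasDerivAt (fun y => sgnPow y a) (a * |y| ^ (a - 1)) y := by
    intro y hy
    rw [abs_of_pos hy]
    refine (Real.hasDerivAt_rpow_const (Or.inl hy.ne')).congr_of_eventuallyEq ?_
    filter_upwards [lt_mem_nhds hy] with z hz using sgnPow_of_pos hz a
  have hne : ∀ y : ℝ, y ≠ 0 → HasDerivAt (fun y => sgnPow y a) (a * |y| ^ (a - 1)) y := by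
    intro y hy
    rcases hy.lt_or_gt with hy | hy
    · have h := (HasDerivAt.scomp y (hpos (-y) (by linarith)) (hasDerivAt_neg y)).neg
      refine (h.congr_deriv (by simp)).congr_of_eventuallyEq (Eventually.of_forall fun z => ?_)
      simp
    · exact hpos y hy
  by_cases hx : x = 0
  · subst hx
    refine hasDerivAt_of_hasDerivAt_of_ne hne ?_ ?_
    · have h : (fun y => sgnPow y a) = fun y => |y| ^ (a - 1) * y :=
        funext (sgnPow_eq_abs_rpow_mul a)
      rw [h]
      exact ((continuous_abs_rpow (by linarith)).mul continuous_id).continuousAt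
    · exact (continuous_const.mul (continuous_abs_rpow (by linarith))).continuousAt
  · exact hne x hx

theorem contDiff_sgnPow {a : ℝ} (ha : 1 < a) : ContDiff ℝ 1 fun y => sgnPow y a := by
  rw [contDiff_one_iff_deriv]
  refine ⟨fun x => (hasDerivAt_sgnPow ha x).differentiableAt, ?_⟩
  rw [funext fun x => (hasDerivAt_sgnPow ha x).deriv]
  exact continuous_const.mul (continuous_abs_rpow (by linarith))

theorem hasDerivAt_abs_rpow_div {q : ℝ} (hq : 1 < q) (x : ℝ) :
    HasDerivAt (fun y : ℝ => |y| ^ q / q) (sgnPow x (q - 1)) x := by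
  refine ((hasDerivAt_abs_rpow x hq).div_const q).congr_deriv ?_
  have hq0 : q ≠ 0 := by linarith
  rcases lt_trichotomy x 0 with hx | rfl | hx
  · obtain ⟨y, rfl⟩ : ∃ y, x = -y := ⟨-x, by simp⟩
    have hy : 0 < y := by linarith
    rw [sgnPow_neg, sgnPow_of_pos hy, abs_neg, abs_of_pos hy,
      show q - 1 = q - 2 + 1 by ring, Real.rpow_add_one hy.ne']
    field_simp
  · simp
  · rw [sgnPow_of_pos hx, abs_of_pos hx, show q - 1 = q - 2 + 1 by ring,
      Real.rpow_add_one hx.ne']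
    field_simp

theorem contDiff_abs_rpow {q : ℝ} (hq : 1 < q) : ContDiff ℝ 1 fun y : ℝ => |y| ^ q := by
  simpa using contDiff_norm_rpow (E := ℝ) hq

/-- Signed powers with exponent in `(0, 1]` are Hölder continuous. -/
theorem abs_sgnPow_sub_sgnPow_le {a : ℝ} (ha : 0 < a) (ha1 : a ≤ 1) (s t : ℝ) :
    |sgnPow s a - sgnPow t a| ≤ 2 * |s - t| ^ a := by
  have same : ∀ s t : ℝ, 0 ≤ t → t ≤ s → |sgnPow s a - sgnPow t a| ≤ 2 * |s - t| ^ a := by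
    intro s t ht hts
    have h := Real.rpow_add_le_add_rpow (sub_nonneg.2 hts) ht ha.le ha1
    rw [sub_add_cancel] at h
    have hmono := Real.rpow_le_rpow ht hts ha.le
    have h0 : 0 ≤ (s - t) ^ a := Real.rpow_nonneg (by linarith) _
    rw [sgnPow_of_nonneg ht ha.ne', sgnPow_of_nonneg (ht.trans hts) ha.ne',
      abs_of_nonneg (by linarith), abs_of_nonneg (by linarith : 0 ≤ s - t)]
    linarith
  have opp : ∀ s t : ℝ, 0 ≤ s → 0 ≤ t → |sgnPow s a - sgnPow (-t) a| ≤ 2 * |s - -t| ^ a := by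
    intro s t hs ht
    have h1 := Real.rpow_le_rpow hs (by linarith : s ≤ s + t) ha.le
    have h2 := Real.rpow_le_rpow ht (by linarith : t ≤ s + t) ha.le
    have h3 := Real.rpow_nonneg hs a
    have h4 := Real.rpow_nonneg ht a
    rw [sgnPow_neg, sgnPow_of_nonneg ht ha.ne', sgnPow_of_nonneg hs ha.ne', sub_neg_eq_add,
      sub_neg_eq_add, abs_of_nonneg (by linarith), abs_of_nonneg (by linarith : 0 ≤ s + t)]
    linarith
  have hnn : ∀ s t : ℝ, 0 ≤ s → |sgnPow s a - sgnPow t a| ≤ 2 * |s - t| ^ a := by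
    intro s t hs
    rcases le_total 0 t with ht | ht
    · rcases le_total t s with h | h
      · exact same s t ht h
      · rw [abs_sub_comm, abs_sub_comm s t]
        exact same t s hs h
    · simpa using opp s (-t) hs (by linarith)
  rcases le_total 0 s with hs | hs
  · exact hnn s t hs
  · have h := hnn (-s) (-t) (by linarith)
    simp only [sgnPow_neg] at h
    rwa [← neg_sub', abs_neg, ← neg_sub', abs_neg] at h

theorem abs_sub_le_of_sgnPow {b : ℝ} (hb : 1 ≤ b) (x v : ℝ) :
    |x - v| ≤ 2 * |sgnPow x b - sgnPow v b| ^ b⁻¹ := by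
  have hb0 : b ≠ 0 := by linarith
  have h := abs_sgnPow_sub_sgnPow_le (inv_pos.2 (by linarith : 0 < b)) (inv_le_one_of_one_le₀ hb)
    (sgnPow x b) (sgnPow v b)
  simpa only [sgnPow_sgnPow, mul_inv_cancel₀ hb0, sgnPow_one] using h

theorem holderConjugate_add_one {b : ℝ} (hb : 0 < b) : (b + 1).HolderConjugate (b⁻¹ + 1) := by
  rw [Real.holderConjugate_iff]
  refine ⟨by linarith, ?_⟩
  field_simp
  ring

/-- The gap in Young's inequality for `x` and `⌊v⌉^b`, written through the powers of `x`, `v`. -/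
theorem rpow_sub_rpow_div_eq {b : ℝ} (hb : 0 < b) (x v : ℝ) :
    (|x| ^ (b + 1) - |v| ^ (b + 1)) / (b + 1) - sgnPow v b * (x - v) =
      |x| ^ (b + 1) / (b + 1) + |sgnPow v b| ^ (b⁻¹ + 1) / (b⁻¹ + 1) - x * sgnPow v b := by
  have h1 : |sgnPow v b| ^ (b⁻¹ + 1) = |v| ^ (b + 1) := by
    rw [abs_sgnPow hb.ne', ← Real.rpow_mul (abs_nonneg v)]
    congr 1
    field_simp
    ring
  have h2 := mul_sgnPow (by linarith : b + 1 ≠ 0) v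
  rw [h1]
  have : sgnPow v b * (x - v) = x * sgnPow v b - |v| ^ (b + 1) := by rw [← h2]; ring
  rw [this]
  field_simp
  ring

theorem rpow_sub_rpow_div_nonneg {b : ℝ} (hb : 0 < b) (x v : ℝ) :
    0 ≤ (|x| ^ (b + 1) - |v| ^ (b + 1)) / (b + 1) - sgnPow v b * (x - v) := by
  rw [rpow_sub_rpow_div_eq hb]
  linarith [Real.young_inequality x (sgnPow v b) (holderConjugate_add_one hb)]

theorem rpow_sub_rpow_div_le {b : ℝ} (hb : 0 < b) (x v : ℝ) :
    (|x| ^ (b + 1) - |v| ^ (b + 1)) / (b + 1) - sgnPow v b * (x - v) ≤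
      (x - v) * (sgnPow x b - sgnPow v b) := by
  have h := rpow_sub_rpow_div_nonneg hb v x
  have h2 : (|v| ^ (b + 1) - |x| ^ (b + 1)) / (b + 1) =
    -((|x| ^ (b + 1) - |v| ^ (b + 1)) / (b + 1)) := by ring
  rw [h2] at h
  linarith

/-! ### Elementary inequalities between monomials -/

/-- Young's inequality with a small parameter, for natural exponents. -/
theorem exists_pow_mul_pow_le (m r : ℕ) (hr : r ≠ 0) {ε : ℝ} (hε : 0 < ε) :
    ∃ K : ℝ, 0 < K ∧ ∀ t y : ℝ, 0 ≤ t → 0 ≤ y →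
      t ^ m * y ^ r ≤ ε * t ^ (m + r) + K * y ^ (m + r) := by
  set η := min ε 1 with hη
  have hη0 : 0 < η := lt_min hε one_pos
  refine ⟨(η⁻¹) ^ m, by positivity, fun t y ht hy => ?_⟩
  rcases le_total y (η * t) with h | h
  · have h1 : y ^ r ≤ ε * t ^ r := calc
      y ^ r ≤ (η * t) ^ r := by gcongr
      _ = η ^ r * t ^ r := mul_pow _ _ _
      _ ≤ ε * t ^ r := by
        gcongr
        exact (pow_le_of_le_one hη0.le (min_le_right _ _) hr).trans (min_le_left _ _)
    have h2 : t ^ m * y ^ r ≤ ε * t ^ (m + r) := calc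
      t ^ m * y ^ r ≤ t ^ m * (ε * t ^ r) := by gcongr
      _ = ε * t ^ (m + r) := by ring
    have : 0 ≤ (η⁻¹) ^ m * y ^ (m + r) := by positivity
    linarith
  · have h1 : t ≤ η⁻¹ * y := by rwa [inv_mul_eq_div, le_div_iff₀' hη0]
    have h2 : t ^ m * y ^ r ≤ (η⁻¹) ^ m * y ^ (m + r) := calc
      t ^ m * y ^ r ≤ (η⁻¹ * y) ^ m * y ^ r := by gcongr
      _ = (η⁻¹) ^ m * y ^ (m + r) := by ring
    have : 0 ≤ ε * t ^ (m + r) := by positivity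
    linarith

/-- The terms of mixed type in the backstepping argument: in a sum of total degree `m + r`, the
monomials that contain a positive power of the newest variables are absorbed by the pure powers. -/
theorem exists_sum_pow_mul_pow_le (i m r : ℕ) (hr : r ≠ 0) {C c : ℝ} (hC : 0 < C) (hc : 0 < c) :
    ∃ K : ℝ, 0 < K ∧ ∀ f g : ℕ → ℝ, (∀ j, 0 ≤ f j) → (∀ j, 0 ≤ g j) →
      C * ((∑ j ∈ Finset.range (i + 1), (f j + g j)) ^ m * (f i + g i) ^ r) ≤
        c * ∑ j ∈ Finset.range i, f j ^ (m + r) +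
          K * (f i ^ (m + r) + ∑ j ∈ Finset.range (i + 1), g j ^ (m + r)) := by
  obtain ⟨s, rfl⟩ : ∃ s, r = s + 1 := ⟨r - 1, by omega⟩
  set M := m + (s + 1) with hM
  set E : ℝ := ((i : ℝ) + 1) ^ (m + s) * 2 ^ (M - 1) with hE
  have hE0 : 0 < E := by positivity
  obtain ⟨K, hK, hY⟩ := exists_pow_mul_pow_le m (s + 1) hr (ε := c / (C * E)) (by positivity)
  refine ⟨c + C * K * 2 ^ (M - 1), by positivity, fun f g hf hg => ?_⟩
  set Θ := ∑ j ∈ Finset.range (i + 1), (f j + g j) with hΘ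
  have hsplit : ∀ j, (f j + g j) ^ M ≤ 2 ^ (M - 1) * (f j ^ M + g j ^ M) :=
    fun j => add_pow_le (hf j) (hg j) M
  have hΘM : Θ ^ M ≤ E * (∑ j ∈ Finset.range (i + 1), f j ^ M +
      ∑ j ∈ Finset.range (i + 1), g j ^ M) := by
    have h1 := pow_sum_le_card_mul_sum_pow (s := Finset.range (i + 1)) (f := fun j => f j + g j)
      (fun j _ => add_nonneg (hf j) (hg j)) (m + s)
    rw [Finset.card_range, Nat.cast_succ] at h1
    refine h1.trans ?_
    rw [hE, mul_assoc, ← Finset.sum_add_distrib, Finset.mul_sum _ _ ((2 : ℝ) ^ (M - 1))]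
    gcongr with j _
    exact hsplit j
  have hΘ0 : 0 ≤ Θ := Finset.sum_nonneg fun j _ => add_nonneg (hf j) (hg j)
  have hgM : ∀ j, 0 ≤ g j ^ M := fun j => pow_nonneg (hg j) M
  have hgi : g i ^ M ≤ ∑ j ∈ Finset.range (i + 1), g j ^ M :=
    Finset.single_le_sum (f := fun j => g j ^ M) (fun j _ => hgM j) (Finset.self_mem_range_succ i)
  calc C * (Θ ^ m * (f i + g i) ^ (s + 1))
      ≤ C * (c / (C * E) * Θ ^ M + K * (f i + g i) ^ M) := by
        gcongr
        exact hY Θ (f i + g i) hΘ0 (add_nonneg (hf i) (hg i))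
    _ ≤ C * (c / (C * E) * (E * (∑ j ∈ Finset.range (i + 1), f j ^ M +
          ∑ j ∈ Finset.range (i + 1), g j ^ M)) + K * (2 ^ (M - 1) *
          (f i ^ M + ∑ j ∈ Finset.range (i + 1), g j ^ M))) := by
        gcongr
        refine (hsplit i).trans ?_
        gcongr
    _ = c * (∑ j ∈ Finset.range (i + 1), f j ^ M + ∑ j ∈ Finset.range (i + 1), g j ^ M) +
          C * K * 2 ^ (M - 1) * (f i ^ M + ∑ j ∈ Finset.range (i + 1), g j ^ M) := by
        field_simp
    _ = _ := by
        rw [Finset.sum_range_succ (fun j => f j ^ M)]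
        ring

/-! ### Weights -/

theorem be_eq {n : ℕ} (hn : 0 < n) {i : ℕ} (hi : i < n) :
    be n i = ((n - 1 + i : ℕ) : ℝ) / ((n - i : ℕ) : ℝ) := by
  have h0 : (n : ℝ) ≠ 0 := by positivity
  rw [Nat.cast_sub hi.le, Nat.cast_add, Nat.cast_sub hn, be]
  split_ifs with h
  · subst h
    simp only [pe]
    push_cast
    field_simp
    ring
  · simp

theorem be_pos {n : ℕ} (hn : 2 ≤ n) {i : ℕ} (hi : i < n) : 0 < be n i := by
  rw [be_eq (by omega) hi]
  have h1 : 0 < n - 1 + i := by omega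
  have h2 : 0 < n - i := by omega
  positivity

theorem one_lt_be {n : ℕ} {i : ℕ} (hi : i + 1 < n) : 1 < be n (i + 1) := by
  rw [be_eq (by omega) hi]
  have h2 : 0 < n - (i + 1) := by omega
  rw [one_lt_div (by positivity)]
  exact_mod_cast (by omega : n - (i + 1) < n - 1 + (i + 1))

theorem pe_div_eq {n : ℕ} (hn : 2 ≤ n) {i : ℕ} (hi : i < n) :
    pe n (i + 2) / (pe n (i + 1) * be n i) =
      ((n - (i + 1) : ℕ) : ℝ) / ((n - 1 + i : ℕ) : ℝ) := by
  rw [be_eq (by omega) hi]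
  have h0 : (n : ℝ) ≠ 0 := by have : 0 < n := by omega
                              positivity
  have h1 : ((n - 1 + i : ℕ) : ℝ) ≠ 0 := by
    have : n - 1 + i ≠ 0 := by omega
    exact_mod_cast this
  have h2 : ((n - i : ℕ) : ℝ) ≠ 0 := by
    have : n - i ≠ 0 := by omega
    exact_mod_cast this
  have e1 : pe n (i + 2) = ((n - (i + 1) : ℕ) : ℝ) / n := by
    rw [Nat.cast_sub (by omega), pe]
    push_cast
    field_simp
    ring
  have e2 : pe n (i + 1) = ((n - i : ℕ) : ℝ) / n := by
    rw [Nat.cast_sub (by omega), pe]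
    push_cast
    field_simp
    ring
  rw [e1, e2]
  field_simp

/-! ### Homogeneous size functions -/

/-- The homogeneous size of `ω_{i+1}`, of weight one. -/
def omSize (n : ℕ) (l : ℕ → ℝ) (x : Fin n → ℝ) (i : ℕ) : ℝ :=
  |omfb n l (i + 1) (emb n x)| ^ ((n - 1 + i : ℕ) : ℝ)⁻¹

/-- The homogeneous size of the disturbance component `d_j`, of weight one. -/
def distSize (n : ℕ) (D : Fin n → ℝ) (j : ℕ) : ℝ := |emb n D j| ^ ((n - j : ℕ) : ℝ)⁻¹

/-- The joint homogeneous size of `ω_1, …, ω_{i+1}` and `d_1, …, d_i`. -/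
def jointSize (n : ℕ) (l : ℕ → ℝ) (x D : Fin n → ℝ) (i : ℕ) : ℝ :=
  ∑ j ∈ Finset.range (i + 1), (omSize n l x j + distSize n D j)

section Size

variable {n : ℕ} {l : ℕ → ℝ} {x D : Fin n → ℝ}

theorem omSize_nonneg (i : ℕ) : 0 ≤ omSize n l x i := Real.rpow_nonneg (abs_nonneg _) _

theorem distSize_nonneg (j : ℕ) : 0 ≤ distSize n D j := Real.rpow_nonneg (abs_nonneg _) _

theorem jointSize_nonneg (i : ℕ) : 0 ≤ jointSize n l x D i :=
  Finset.sum_nonneg fun _ _ => add_nonneg (omSize_nonneg _) (distSize_nonneg _)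

theorem jointSize_succ (i : ℕ) : jointSize n l x D (i + 1) =
    jointSize n l x D i + (omSize n l x (i + 1) + distSize n D (i + 1)) :=
  Finset.sum_range_succ _ _

theorem jointSize_le_succ (i : ℕ) : jointSize n l x D i ≤ jointSize n l x D (i + 1) := by
  rw [jointSize_succ]
  linarith [omSize_nonneg (n := n) (l := l) (x := x) (i + 1), distSize_nonneg (D := D) (i + 1)]

theorem add_le_jointSize (i : ℕ) : omSize n l x i + distSize n D i ≤ jointSize n l x D i :=
  Finset.single_le_sum (f := fun j => omSize n l x j + distSize n D j)
    (fun _ _ => add_nonneg (omSize_nonneg _) (distSize_nonneg _)) (Finset.self_mem_range_succ i)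

theorem omSize_le_jointSize (i : ℕ) : omSize n l x i ≤ jointSize n l x D i := by
  linarith [add_le_jointSize (l := l) (x := x) (D := D) i, distSize_nonneg (D := D) i]

theorem distSize_le_jointSize (i : ℕ) : distSize n D i ≤ jointSize n l x D i := by
  linarith [add_le_jointSize (l := l) (x := x) (D := D) i, omSize_nonneg (l := l) (x := x) i]

theorem omSize_pow (hn : 2 ≤ n) (i : ℕ) :
    omSize n l x i ^ (n - 1 + i) = |omfb n l (i + 1) (emb n x)| :=
  Real.rpow_inv_natCast_pow (abs_nonneg _) (by omega)

theorem distSize_pow {j : ℕ} (hj : j < n) : distSize n D j ^ (n - j) = |emb n D j| :=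
  Real.rpow_inv_natCast_pow (abs_nonneg _) (by omega)

theorem abs_omfb_rpow (i k : ℕ) :
    |omfb n l (i + 1) (emb n x)| ^ ((k : ℝ) / ((n - 1 + i : ℕ) : ℝ)) = omSize n l x i ^ k := by
  rw [omSize, ← Real.rpow_natCast, ← Real.rpow_mul (abs_nonneg _), inv_mul_eq_div]

theorem vfb_succ (hn : 2 ≤ n) {i : ℕ} (hi : i < n) (y : ℕ → ℝ) :
    vfb n l (i + 1) y = -l (i + 1) * sgnPow (omfb n l (i + 1) y)
      (((n - (i + 1) : ℕ) : ℝ) / ((n - 1 + i : ℕ) : ℝ)) := by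
  rw [← pe_div_eq hn hi]
  rfl

theorem abs_vfb_succ (hn : 2 ≤ n) (hl : ∀ i, 0 < l i) {i : ℕ} (hi : i + 1 < n) :
    |vfb n l (i + 1) (emb n x)| = l (i + 1) * omSize n l x i ^ (n - (i + 1)) := by
  have h1 : 0 < n - (i + 1) := by omega
  have h2 : 0 < n - 1 + i := by omega
  rw [vfb_succ hn (by omega), abs_mul, abs_neg, abs_of_pos (hl _), abs_sgnPow (by positivity),
    abs_omfb_rpow]

theorem omfb_mul_vfb (hn : 2 ≤ n) {i : ℕ} (hi : i + 1 < n) :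
    omfb n l (i + 1) (emb n x) * vfb n l (i + 1) (emb n x) =
      -l (i + 1) * omSize n l x i ^ (2 * n - 2) := by
  have h1 : 0 < n - (i + 1) := by omega
  have h2 : 0 < n - 1 + i := by omega
  have h3 : ((n - (i + 1) : ℕ) : ℝ) / ((n - 1 + i : ℕ) : ℝ) + 1 =
      ((2 * n - 2 : ℕ) : ℝ) / ((n - 1 + i : ℕ) : ℝ) := by
    rw [show 2 * n - 2 = n - (i + 1) + (n - 1 + i) by omega]
    rw [Nat.cast_add (n - (i + 1)), add_div, div_self (by positivity)]
  rw [vfb_succ hn (by omega), mul_left_comm, mul_sgnPow (by positivity), h3, abs_omfb_rpow]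

theorem abs_sub_vfb_le (hn : 2 ≤ n) {i : ℕ} (hi : i < n) :
    |emb n x (i + 1) - vfb n l i (emb n x)| ≤ 2 * omSize n l x i ^ (n - i) := by
  have hb := be_eq (by omega) hi
  have hinv : (be n i)⁻¹ = ((n - i : ℕ) : ℝ) / ((n - 1 + i : ℕ) : ℝ) := by rw [hb, inv_div]
  have hom : omfb n l (i + 1) (emb n x) =
    sgnPow (emb n x (i + 1)) (be n i) - sgnPow (vfb n l i (emb n x)) (be n i) := rfl
  rw [← abs_omfb_rpow, ← hinv, hom]
  rcases Nat.eq_zero_or_pos i with rfl | h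
  · have hb0 := be_pos hn hi
    have hv : vfb n l 0 (emb n x) = 0 := rfl
    rw [hv, sgnPow_zero_left, sub_zero, sub_zero, abs_sgnPow hb0.ne',
      Real.rpow_rpow_inv (abs_nonneg _) hb0.ne']
    linarith [abs_nonneg (emb n x (0 + 1))]
  · obtain ⟨k, rfl⟩ : ∃ k, i = k + 1 := ⟨i - 1, by omega⟩
    exact abs_sub_le_of_sgnPow (one_lt_be hi).le _ _

theorem abs_emb_le (hn : 2 ≤ n) (hl : ∀ i, 0 < l i) {i : ℕ} (hi : i < n) :
    |emb n x (i + 1)| ≤ (2 + l i) * jointSize n l x D i ^ (n - i) := by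
  have h1 := abs_sub_vfb_le (l := l) (x := x) hn hi
  have h2 : |vfb n l i (emb n x)| ≤ l i * jointSize n l x D i ^ (n - i) := by
    rcases Nat.eq_zero_or_pos i with rfl | h
    · have hv : vfb n l 0 (emb n x) = 0 := rfl
      rw [hv, abs_zero]
      exact mul_nonneg (hl 0).le (pow_nonneg (jointSize_nonneg _) _)
    · obtain ⟨k, rfl⟩ : ∃ k, i = k + 1 := ⟨i - 1, by omega⟩
      rw [abs_vfb_succ hn hl hi]
      have := (hl (k + 1)).le
      have h0 := omSize_nonneg (l := l) (x := x) k
      gcongr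
      exact (omSize_le_jointSize k).trans (jointSize_le_succ k)
  have h3 : omSize n l x i ^ (n - i) ≤ jointSize n l x D i ^ (n - i) :=
    pow_le_pow_left₀ (omSize_nonneg _) (omSize_le_jointSize _) _
  have h4 := abs_sub_abs_le_abs_sub (emb n x (i + 1)) (vfb n l i (emb n x))
  linarith

end Size

/-! ### Differentiability of the virtual controls -/

/-- The coordinate `x ↦ emb n x j` as a continuous linear functional. -/
def embCLM (n j : ℕ) : (Fin n → ℝ) →L[ℝ] ℝ :=
  if h : 1 ≤ j ∧ j ≤ n then ContinuousLinearMap.proj ⟨j - 1, by omega⟩ else 0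

theorem embCLM_apply (n j : ℕ) (x : Fin n → ℝ) : embCLM n j x = emb n x j := by
  unfold embCLM emb
  split_ifs <;> rfl

theorem hasFDerivAt_emb (n j : ℕ) (x : Fin n → ℝ) :
    HasFDerivAt (fun y => emb n y j) (embCLM n j) x := by
  simp only [← embCLM_apply]
  exact (embCLM n j).hasFDerivAt

theorem contDiff_emb (n j : ℕ) : ContDiff ℝ 1 fun y : Fin n → ℝ => emb n y j := by
  simp only [← embCLM_apply]
  exact (embCLM n j).contDiff

/-- The function `⌊v_i⌉^{β_i}` on `ℝ^n`. -/
def vpow (n : ℕ) (l : ℕ → ℝ) (i : ℕ) (y : Fin n → ℝ) : ℝ :=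
  sgnPow (vfb n l i (emb n y)) (be n i)

theorem vpow_zero (n : ℕ) (l : ℕ → ℝ) : vpow n l 0 = fun _ => 0 :=
  funext fun _ => sgnPow_zero_left _

theorem omfb_succ_eq (n : ℕ) (l : ℕ → ℝ) (i : ℕ) (y : Fin n → ℝ) :
    omfb n l (i + 1) (emb n y) = sgnPow (emb n y (i + 1)) (be n i) - vpow n l i y := rfl

section Derivative

variable {n : ℕ} {l : ℕ → ℝ}

theorem vpow_succ (hn : 2 ≤ n) (hl : ∀ i, 0 < l i) {i : ℕ} (hi : i + 1 < n) (y : Fin n → ℝ) :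
    vpow n l (i + 1) y = -l (i + 1) ^ be n (i + 1) * sgnPow (omfb n l (i + 1) (emb n y))
      (((n - 1 + (i + 1) : ℕ) : ℝ) / ((n - 1 + i : ℕ) : ℝ)) := by
  have h1 : 0 < n - (i + 1) := by omega
  have h2 : 0 < n - 1 + i := by omega
  rw [vpow, vfb_succ hn (by omega), neg_mul, sgnPow_neg, sgnPow_mul_of_pos (hl _), sgnPow_sgnPow,
    neg_mul]
  congr 3
  rw [be_eq (by omega) hi]
  have h3 : ((n - (i + 1) : ℕ) : ℝ) ≠ 0 := by positivity
  have h4 : ((n - 1 + i : ℕ) : ℝ) ≠ 0 := by positivity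
  field_simp

theorem vpow_one (hn : 2 ≤ n) (hl : ∀ i, 0 < l i) (y : Fin n → ℝ) :
    vpow n l 1 y = -l 1 ^ be n 1 * emb n y 1 := by
  have h := vpow_succ hn hl (i := 0) (by omega) y
  rw [omfb_succ_eq, vpow_zero, sub_zero, sgnPow_sgnPow] at h
  rw [h]
  have h1 : ((n - 1 : ℕ) : ℝ) ≠ 0 := by
    have : n - 1 ≠ 0 := by omega
    exact_mod_cast this
  have h2 : (n : ℝ) ≠ 0 := by
    have : n ≠ 0 := by omega
    exact_mod_cast this
  have e : be n 0 * (((n - 1 + (0 + 1) : ℕ) : ℝ) / ((n - 1 + 0 : ℕ) : ℝ)) = 1 := by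
    rw [be_eq (by omega) (by omega), show n - 1 + (0 + 1) = n by omega, Nat.add_zero, Nat.sub_zero]
    field_simp
  rw [e, sgnPow_one]

theorem one_lt_weight_ratio (hn : 2 ≤ n) (i : ℕ) :
    1 < ((n - 1 + (i + 1) : ℕ) : ℝ) / ((n - 1 + i : ℕ) : ℝ) := by
  have h : 0 < n - 1 + i := by omega
  rw [one_lt_div (by positivity)]
  exact_mod_cast (by omega : n - 1 + i < n - 1 + (i + 1))

theorem contDiff_vpow (hn : 2 ≤ n) (hl : ∀ i, 0 < l i) :
    ∀ i, i < n → ContDiff ℝ 1 (vpow n l i)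
  | 0, _ => by
    rw [vpow_zero]
    exact contDiff_const
  | 1, _ => by
    rw [funext (vpow_one hn hl)]
    exact contDiff_const.mul (contDiff_emb n 1)
  | i + 2, hi => by
    rw [funext (vpow_succ hn hl hi)]
    refine contDiff_const.mul ((contDiff_sgnPow (one_lt_weight_ratio hn _)).comp ?_)
    simp only [omfb_succ_eq]
    exact ((contDiff_sgnPow (one_lt_be (by omega))).comp (contDiff_emb n _)).sub
      (contDiff_vpow hn hl (i + 1) (by omega))

theorem hasFDerivAt_vpow (hn : 2 ≤ n) (hl : ∀ i, 0 < l i) {i : ℕ} (hi : i < n) (x : Fin n → ℝ) :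
    HasFDerivAt (vpow n l i) (fderiv ℝ (vpow n l i) x) x :=
  ((contDiff_vpow hn hl i hi).differentiable one_ne_zero x).hasFDerivAt

theorem fderiv_vpow_one (hn : 2 ≤ n) (hl : ∀ i, 0 < l i) (x h : Fin n → ℝ) :
    fderiv ℝ (vpow n l 1) x h = -l 1 ^ be n 1 * emb n h 1 := by
  rw [funext (vpow_one hn hl), ((hasFDerivAt_emb n 1 x).const_mul _).fderiv]
  simp [embCLM_apply]

theorem fderiv_vpow_add_two (hn : 2 ≤ n) (hl : ∀ i, 0 < l i) {i : ℕ} (hi : i + 2 < n)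
    (x h : Fin n → ℝ) :
    fderiv ℝ (vpow n l (i + 2)) x h =
      -l (i + 2) ^ be n (i + 2) * (((n - 1 + (i + 2) : ℕ) : ℝ) / ((n - 1 + (i + 1) : ℕ) : ℝ) *
        omSize n l x (i + 1) * (be n (i + 1) * |emb n x (i + 2)| ^ (be n (i + 1) - 1) *
          emb n h (i + 2) - fderiv ℝ (vpow n l (i + 1)) x h)) := by
  have hom : HasFDerivAt (fun y => omfb n l (i + 2) (emb n y))
      ((be n (i + 1) * |emb n x (i + 2)| ^ (be n (i + 1) - 1)) • embCLM n (i + 2) -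
        fderiv ℝ (vpow n l (i + 1)) x) x :=
    ((hasDerivAt_sgnPow (one_lt_be (by omega)) _).comp_hasFDerivAt x
      (hasFDerivAt_emb n (i + 2) x)).sub (hasFDerivAt_vpow hn hl (by omega) x)
  have hd := ((hasDerivAt_sgnPow (one_lt_weight_ratio hn (i + 1)) _).comp_hasFDerivAt x
    hom).const_mul (-l (i + 2) ^ be n (i + 2))
  have hexp : ((n - 1 + (i + 1 + 1) : ℕ) : ℝ) / ((n - 1 + (i + 1) : ℕ) : ℝ) - 1 =
      ((n - 1 + (i + 1) : ℕ) : ℝ)⁻¹ := by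
    have h0 : 0 < n - 1 + (i + 1) := by omega
    rw [← Nat.add_assoc, Nat.cast_succ, add_div, div_self (by positivity), one_div,
      add_sub_cancel_left]
  rw [hexp] at hd
  rw [funext (vpow_succ hn hl hi)]
  refine (congrArg (fun L : (Fin n → ℝ) →L[ℝ] ℝ => L h) hd.fderiv).trans ?_
  simp only [FunLike.coe_smul, FunLike.coe_sub, Pi.smul_apply, Pi.sub_apply, smul_eq_mul,
    embCLM_apply]
  rfl

/-- Along a perturbed chain of integrators, the derivative of `⌊v_{i+1}⌉^{β_{i+1}}` is bounded by
the power of the joint size prescribed by homogeneity. -/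
theorem exists_abs_fderiv_vpow_le (hn : 2 ≤ n) (hl : ∀ i, 0 < l i) (i : ℕ) (hi : i + 1 < n) :
    ∃ C : ℝ, 0 < C ∧ ∀ x h D : Fin n → ℝ,
      (∀ j, j + 1 < n → emb n h (j + 1) = emb n x (j + 2) + emb n D (j + 1)) →
      |fderiv ℝ (vpow n l (i + 1)) x h| ≤ C * jointSize n l x D (i + 1) ^ (n - 1 + i) := by
  have hstep : ∀ j, j + 1 < n → ∀ x h D : Fin n → ℝ,
      (∀ j, j + 1 < n → emb n h (j + 1) = emb n x (j + 2) + emb n D (j + 1)) →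
      |emb n h (j + 1)| ≤ (3 + l (j + 1)) * jointSize n l x D (j + 1) ^ (n - (j + 1)) := by
    intro j hj x h D hh
    have h1 := abs_emb_le (x := x) (D := D) hn hl hj
    have h2 : |emb n D (j + 1)| ≤ jointSize n l x D (j + 1) ^ (n - (j + 1)) := by
      rw [← distSize_pow hj]
      exact pow_le_pow_left₀ (distSize_nonneg _) (distSize_le_jointSize _) _
    rw [hh j hj]
    have h3 := abs_add_le (emb n x (j + 2)) (emb n D (j + 1))
    linarith
  induction i with
  | zero =>
    refine ⟨l 1 ^ be n 1 * (3 + l 1), ?_, fun x h D hh => ?_⟩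
    · have := hl 1
      positivity
    · have h1 := hstep 0 hi x h D hh
      have h2 := Real.rpow_pos_of_pos (hl 1) (be n 1)
      rw [zero_add, fderiv_vpow_one hn hl, abs_mul, abs_neg, abs_of_pos h2, mul_assoc]
      gcongr
      exact h1
  | succ i ih =>
    obtain ⟨C, hC, hb⟩ := ih (by omega)
    have hl1 := hl (i + 1)
    have hl2 := hl (i + 2)
    have hβ := be_pos hn (by omega : i + 1 < n)
    have hL := Real.rpow_pos_of_pos hl2 (be n (i + 2))
    have hq : 0 < ((n - 1 + (i + 2) : ℕ) : ℝ) / ((n - 1 + (i + 1) : ℕ) : ℝ) :=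
      one_pos.trans (one_lt_weight_ratio hn (i + 1))
    set q := ((n - 1 + (i + 2) : ℕ) : ℝ) / ((n - 1 + (i + 1) : ℕ) : ℝ) with hqdef
    set β := be n (i + 1) with hβdef
    set L := l (i + 2) ^ be n (i + 2) with hLdef
    refine ⟨L * (q * (β * (2 + l (i + 1)) ^ (β - 1) * (3 + l (i + 2)) + C)), by positivity,
      fun x h D hh => ?_⟩
    set Θ := jointSize n l x D (i + 2) with hΘ
    have hΘ1 : jointSize n l x D (i + 1) ≤ Θ := jointSize_le_succ _
    have hΘ10 : 0 ≤ jointSize n l x D (i + 1) := jointSize_nonneg _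
    have hΘ0 : 0 ≤ Θ := jointSize_nonneg _
    have h1 : |fderiv ℝ (vpow n l (i + 1)) x h| ≤ C * Θ ^ (n - 1 + i) :=
      (hb x h D hh).trans (by gcongr)
    have h2 : |emb n h (i + 2)| ≤ (3 + l (i + 2)) * Θ ^ (n - (i + 2)) := hstep (i + 1) hi x h D hh
    have hx : |emb n x (i + 2)| ≤ (2 + l (i + 1)) * Θ ^ (n - (i + 1)) :=
      (abs_emb_le (x := x) (D := D) hn hl (by omega)).trans (by gcongr)
    have hexp : ((n - (i + 1) : ℕ) : ℝ) * (β - 1) = ((2 * i + 1 : ℕ) : ℝ) := by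
      have h0 : 0 < n - (i + 1) := by omega
      rw [hβdef, be_eq (by omega) (by omega), mul_sub, mul_div_cancel₀ _ (by positivity), mul_one,
        show n - 1 + (i + 1) = 2 * i + 1 + (n - (i + 1)) by omega, Nat.cast_add (2 * i + 1),
        add_sub_cancel_right]
    have h3 : |emb n x (i + 2)| ^ (β - 1) ≤ (2 + l (i + 1)) ^ (β - 1) * Θ ^ (2 * i + 1) := by
      have hβ1 : 0 ≤ β - 1 := by linarith [one_lt_be (by omega : i + 1 < n)]
      refine (Real.rpow_le_rpow (abs_nonneg _) hx hβ1).trans ?_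
      rw [Real.mul_rpow (by positivity) (by positivity), ← Real.rpow_natCast Θ (n - (i + 1)),
        ← Real.rpow_mul hΘ0, ← Real.rpow_natCast Θ (2 * i + 1), hexp]
    have h4 : omSize n l x (i + 1) ≤ Θ := (omSize_le_jointSize _).trans hΘ1
    have h40 := omSize_nonneg (l := l) (x := x) (i + 1)
    rw [fderiv_vpow_add_two hn hl hi, abs_mul, abs_neg, abs_of_pos hL, abs_mul, abs_mul,
      abs_of_pos hq, abs_of_nonneg h40]
    have h5 : |β * |emb n x (i + 2)| ^ (β - 1) * emb n h (i + 2) -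
        fderiv ℝ (vpow n l (i + 1)) x h| ≤
        (β * (2 + l (i + 1)) ^ (β - 1) * (3 + l (i + 2)) + C) * Θ ^ (n - 1 + i) := by
      refine (abs_sub _ _).trans ?_
      rw [abs_mul, abs_mul, abs_of_pos hβ, abs_of_nonneg (Real.rpow_nonneg (abs_nonneg _) _)]
      calc _ ≤ β * ((2 + l (i + 1)) ^ (β - 1) * Θ ^ (2 * i + 1)) *
            ((3 + l (i + 2)) * Θ ^ (n - (i + 2))) + C * Θ ^ (n - 1 + i) := by gcongr
        _ = _ := by
          rw [show n - 1 + i = 2 * i + 1 + (n - (i + 2)) by omega, pow_add]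
          ring
    calc _ ≤ L * (q * Θ * ((β * (2 + l (i + 1)) ^ (β - 1) * (3 + l (i + 2)) + C) *
          Θ ^ (n - 1 + i))) := by gcongr
      _ = _ := by
        rw [← Nat.add_assoc, pow_succ]
        ring

end Derivative

/-! ### The Lyapunov function -/

section Lyapunov

variable {n : ℕ} {l : ℕ → ℝ}

theorem Wfb_succ_eq (hn : 2 ≤ n) {i : ℕ} (hi : i < n) (y : Fin n → ℝ) :
    Wfb n l (i + 1) (emb n y) = |emb n y (i + 1)| ^ (be n i + 1) / (be n i + 1) +
      |vpow n l i y| ^ ((be n i)⁻¹ + 1) / ((be n i)⁻¹ + 1) - emb n y (i + 1) * vpow n l i y :=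
  rpow_sub_rpow_div_eq (be_pos hn hi) _ _

theorem Vn_eq_sum_range (y : Fin n → ℝ) :
    Vn n l y = ∑ i ∈ Finset.range n, Wfb n l (i + 1) (emb n y) := by
  rw [Vn, Finset.range_eq_Ico, Finset.sum_Ico_add' (fun i => Wfb n l i (emb n y)) 0 n 1]
  rfl

theorem contDiff_Vn (hn : 2 ≤ n) (hl : ∀ i, 0 < l i) : ContDiff ℝ 1 (Vn n l) := by
  rw [funext Vn_eq_sum_range]
  refine ContDiff.sum fun i hi => ?_
  have hi := Finset.mem_range.1 hi
  have hb := be_pos hn hi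
  have hb' := inv_pos.2 hb
  rw [funext (Wfb_succ_eq hn hi)]
  have hv := contDiff_vpow hn hl i hi
  exact ((((contDiff_abs_rpow (by linarith)).comp (contDiff_emb n _)).div_const _).add
    (((contDiff_abs_rpow (by linarith)).comp hv).div_const _)).sub ((contDiff_emb n _).mul hv)

theorem hasFDerivAt_Wfb (hn : 2 ≤ n) (hl : ∀ i, 0 < l i) {i : ℕ} (hi : i < n) (x : Fin n → ℝ) :
    HasFDerivAt (fun y => Wfb n l (i + 1) (emb n y))
      (omfb n l (i + 1) (emb n x) • embCLM n (i + 1) -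
        (emb n x (i + 1) - vfb n l i (emb n x)) • fderiv ℝ (vpow n l i) x) x := by
  have hb := be_pos hn hi
  have hb' := inv_pos.2 hb
  have hv := hasFDerivAt_vpow hn hl hi x
  have he := hasFDerivAt_emb n (i + 1) x
  have h := (((hasDerivAt_abs_rpow_div (by linarith : 1 < be n i + 1) _).comp_hasFDerivAt x
    he).add ((hasDerivAt_abs_rpow_div (by linarith : 1 < (be n i)⁻¹ + 1) _).comp_hasFDerivAt x
    hv)).sub (he.mul hv)
  rw [funext (Wfb_succ_eq hn hi)]
  refine h.congr_fderiv ?_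
  have h1 : sgnPow (vpow n l i x) ((be n i)⁻¹ + 1 - 1) = vfb n l i (emb n x) := by
    rw [vpow, sgnPow_sgnPow, add_sub_cancel_right, mul_inv_cancel₀ hb.ne', sgnPow_one]
  rw [h1, omfb_succ_eq, add_sub_cancel_right]
  module

theorem fderiv_Vn (hn : 2 ≤ n) (hl : ∀ i, 0 < l i) (x h : Fin n → ℝ) :
    fderiv ℝ (Vn n l) x h = ∑ i ∈ Finset.range n, (omfb n l (i + 1) (emb n x) * emb n h (i + 1) -
      (emb n x (i + 1) - vfb n l i (emb n x)) * fderiv ℝ (vpow n l i) x h) := by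
  rw [funext Vn_eq_sum_range, (HasFDerivAt.fun_sum fun i hi =>
    hasFDerivAt_Wfb hn hl (Finset.mem_range.1 hi) x).fderiv, _root_.sum_apply]
  simp only [FunLike.coe_smul, FunLike.coe_sub, Pi.smul_apply, Pi.sub_apply, smul_eq_mul,
    embCLM_apply]

theorem Vn_nonneg (hn : 2 ≤ n) (x : Fin n → ℝ) : 0 ≤ Vn n l x := by
  rw [Vn_eq_sum_range]
  exact Finset.sum_nonneg fun i hi =>
    rpow_sub_rpow_div_nonneg (be_pos hn (Finset.mem_range.1 hi)) _ _

theorem Wfb_le (hn : 2 ≤ n) {i : ℕ} (hi : i < n) (x : Fin n → ℝ) :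
    Wfb n l (i + 1) (emb n x) ≤ 2 * omSize n l x i ^ (2 * n - 1) := by
  have h1 := abs_sub_vfb_le (l := l) (x := x) hn hi
  have h2 := omSize_pow (l := l) (x := x) hn i
  calc Wfb n l (i + 1) (emb n x)
      ≤ (emb n x (i + 1) - vfb n l i (emb n x)) * omfb n l (i + 1) (emb n x) :=
        rpow_sub_rpow_div_le (be_pos hn hi) _ _
    _ ≤ |emb n x (i + 1) - vfb n l i (emb n x)| * |omfb n l (i + 1) (emb n x)| := by
        rw [← abs_mul]
        exact le_abs_self _
    _ ≤ 2 * omSize n l x i ^ (n - i) * omSize n l x i ^ (n - 1 + i) := by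
        rw [h2]
        gcongr
    _ = 2 * omSize n l x i ^ (2 * n - 1) := by
        rw [mul_assoc, ← pow_add, show n - i + (n - 1 + i) = 2 * n - 1 by omega]

theorem exists_Vn_rpow_le (hn : 2 ≤ n) (l : ℕ → ℝ) :
    ∃ C : ℝ, 0 < C ∧ ∀ x : Fin n → ℝ,
      Vn n l x ^ al n ≤ C * ∑ i ∈ Finset.range n, omSize n l x i ^ (2 * n - 2) := by
  have hα0 : 0 ≤ al n := by
    have : (2 : ℝ) ≤ n := by exact_mod_cast hn
    exact div_nonneg (by linarith) (by linarith)
  have hα : ((2 * n - 1 : ℕ) : ℝ) * al n = ((2 * n - 2 : ℕ) : ℝ) := by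
    have h0 : (2 : ℝ) ≤ n := by exact_mod_cast hn
    rw [Nat.cast_sub (by omega), Nat.cast_sub (by omega), al]
    push_cast
    rw [mul_div_cancel₀ _ (by linarith)]
    ring
  refine ⟨2 ^ al n * (n : ℝ) ^ (2 * n - 3), by have : 0 < n := by omega
                                               positivity, fun x => ?_⟩
  set S := ∑ i ∈ Finset.range n, omSize n l x i with hS
  have hS0 : 0 ≤ S := Finset.sum_nonneg fun i _ => omSize_nonneg i
  have h1 : Vn n l x ≤ 2 * S ^ (2 * n - 1) := by
    rw [Vn_eq_sum_range]
    calc _ ≤ ∑ i ∈ Finset.range n, 2 * (omSize n l x i * S ^ (2 * n - 2)) := by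
          refine Finset.sum_le_sum fun i hi => (Wfb_le hn (Finset.mem_range.1 hi) x).trans ?_
          rw [show 2 * n - 1 = 2 * n - 2 + 1 by omega, pow_succ']
          have h0 := omSize_nonneg (l := l) (x := x) i
          gcongr
          exact Finset.single_le_sum (f := omSize n l x) (fun i _ => omSize_nonneg i) hi
      _ = 2 * S ^ (2 * n - 1) := by
          rw [← Finset.mul_sum, ← Finset.sum_mul, ← hS, ← pow_succ',
            show 2 * n - 2 + 1 = 2 * n - 1 by omega]
  have h2 := pow_sum_le_card_mul_sum_pow (s := Finset.range n) (f := omSize n l x)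
    (fun i _ => omSize_nonneg i) (2 * n - 3)
  rw [Finset.card_range, show 2 * n - 3 + 1 = 2 * n - 2 by omega] at h2
  calc Vn n l x ^ al n ≤ (2 * S ^ (2 * n - 1)) ^ al n :=
        Real.rpow_le_rpow (Vn_nonneg hn x) h1 hα0
    _ = 2 ^ al n * S ^ (2 * n - 2) := by
        rw [Real.mul_rpow (by norm_num) (by positivity), ← Real.rpow_natCast S,
          ← Real.rpow_mul hS0, hα, Real.rpow_natCast]
    _ ≤ 2 ^ al n * ((n : ℝ) ^ (2 * n - 3) *
          ∑ i ∈ Finset.range n, omSize n l x i ^ (2 * n - 2)) := by gcongr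
    _ = _ := by ring

/-! ### Choice of the gains -/

theorem vfb_congr {l l' : ℕ → ℝ} (y : ℕ → ℝ) :
    ∀ i, (∀ j ≤ i, l j = l' j) → vfb n l i y = vfb n l' i y
  | 0, _ => rfl
  | i + 1, h => by
    rw [vfb, vfb, vfb_congr y i fun j hj => h j (by omega), h (i + 1) le_rfl]

theorem omfb_congr {l l' : ℕ → ℝ} (y : ℕ → ℝ) (i : ℕ) (h : ∀ j ≤ i, l j = l' j) :
    omfb n l (i + 1) y = omfb n l' (i + 1) y := by
  simp only [omfb, Nat.add_sub_cancel, vfb_congr y i h]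

theorem vpow_congr {l l' : ℕ → ℝ} (i : ℕ) (h : ∀ j ≤ i, l j = l' j) :
    vpow n l i = vpow n l' i :=
  funext fun y => by rw [vpow, vpow, vfb_congr _ i h]

theorem omSize_congr {l l' : ℕ → ℝ} (x : Fin n → ℝ) (i : ℕ) (h : ∀ j ≤ i, l j = l' j) :
    omSize n l x i = omSize n l' x i := by
  rw [omSize, omSize, omfb_congr _ i h]

/-- The dissipation inequality for the first `i` steps of the backstepping procedure, in which the
term with the next input `x_{i+2}` has not been used yet. -/
def StageBound (n : ℕ) (l : ℕ → ℝ) (i : ℕ) (c K : ℝ) : Prop :=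
  ∀ x h D : Fin n → ℝ,
    (∀ j, j + 1 < n → emb n h (j + 1) = emb n x (j + 2) + emb n D (j + 1)) →
    ∑ j ∈ Finset.range i, (omfb n l (j + 1) (emb n x) * emb n h (j + 1) -
      (emb n x (j + 2) - vfb n l (j + 1) (emb n x)) * fderiv ℝ (vpow n l (j + 1)) x h) ≤
    -c * ∑ j ∈ Finset.range i, omSize n l x j ^ (2 * n - 2) +
      K * (omSize n l x i ^ (2 * n - 2) +
        ∑ j ∈ Finset.range (i + 1), distSize n D j ^ (2 * n - 2))

theorem StageBound.congr {l l' : ℕ → ℝ} {i : ℕ} {c K : ℝ} (hb : StageBound n l i c K)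
    (h : ∀ j ≤ i, l j = l' j) : StageBound n l' i c K := by
  intro x v D hv
  have h1 := hb x v D hv
  have h2 : ∑ j ∈ Finset.range i, omSize n l x j ^ (2 * n - 2) =
      ∑ j ∈ Finset.range i, omSize n l' x j ^ (2 * n - 2) :=
    Finset.sum_congr rfl fun j hj => by
      rw [omSize_congr x j fun k hk => h k (hk.trans (Finset.mem_range.1 hj).le)]
  rw [omSize_congr x i h, h2] at h1
  refine le_of_eq_of_le (Finset.sum_congr rfl fun j hj => ?_) h1
  have hj' := Finset.mem_range.1 hj
  rw [omfb_congr _ j fun k hk => h k (by omega), vfb_congr _ (j + 1) fun k hk => h k (by omega),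
    vpow_congr (j + 1) fun k hk => h k (by omega)]

theorem StageBound.succ (hn : 2 ≤ n) (hl : ∀ i, 0 < l i) {i : ℕ} (hi : i + 1 < n) {c K : ℝ}
    (hc : 0 < c) (hb : StageBound n l i c K) (hli : l (i + 1) = K + c) :
    ∃ K' : ℝ, 0 < K' ∧ StageBound n l (i + 1) (c / 2) K' := by
  obtain ⟨C, hC, hder⟩ := exists_abs_fderiv_vpow_le hn hl i hi
  obtain ⟨K₁, hK₁, hmix⟩ := exists_sum_pow_mul_pow_le (i + 1) (n - 1 + i) (n - (i + 1)) (by omega)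
    (C := 3 + 2 * C) (c := c / 2) (by positivity) (by positivity)
  have hM : n - 1 + i + (n - (i + 1)) = 2 * n - 2 := by omega
  rw [hM] at hmix
  refine ⟨|K| + K₁, by positivity, fun x h D hh => ?_⟩
  have hmix := hmix (omSize n l x) (distSize n D) omSize_nonneg distSize_nonneg
  have hprev := hb x h D hh
  have hder := hder x h D hh
  change (3 + 2 * C) * (jointSize n l x D (i + 1) ^ _ * _) ≤ _ at hmix
  set Θ := jointSize n l x D (i + 1) with hΘ
  set ν := omSize n l x with hν
  set δ := distSize n D with hδ
  set ω := omfb n l (i + 1) (emb n x) with hω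
  set v := vfb n l (i + 1) (emb n x) with hv
  set M := 2 * n - 2 with hMdef
  have hν0 : ∀ j, 0 ≤ ν j := omSize_nonneg
  have hδ0 : ∀ j, 0 ≤ δ j := distSize_nonneg
  have hΘ0 : 0 ≤ Θ := jointSize_nonneg _
  have hωv : ω * v = -l (i + 1) * ν i ^ M := omfb_mul_vfb hn hi
  have hωΘ : |ω| ≤ Θ ^ (n - 1 + i) := by
    rw [← omSize_pow hn i]
    exact pow_le_pow_left₀ (hν0 i) ((omSize_le_jointSize i).trans (jointSize_le_succ i)) _
  have hdiff : |emb n x (i + 2) - v| ≤ 2 * (ν (i + 1) + δ (i + 1)) ^ (n - (i + 1)) :=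
    (abs_sub_vfb_le hn hi).trans (by
      have := hν0 (i + 1)
      have := hδ0 (i + 1)
      gcongr
      linarith)
  have hdist : |emb n D (i + 1)| ≤ (ν (i + 1) + δ (i + 1)) ^ (n - (i + 1)) := by
    rw [← distSize_pow hi]
    exact pow_le_pow_left₀ (hδ0 _) (by linarith [hν0 (i + 1)]) _
  set Y := (ν (i + 1) + δ (i + 1)) ^ (n - (i + 1)) with hY
  have hY0 : 0 ≤ Y := (abs_nonneg _).trans hdist
  have hnew : ω * emb n h (i + 1) - (emb n x (i + 2) - v) * fderiv ℝ (vpow n l (i + 1)) x h ≤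
      -l (i + 1) * ν i ^ M + (3 + 2 * C) * (Θ ^ (n - 1 + i) * Y) := by
    have e : ω * emb n h (i + 1) = ω * v + ω * (emb n x (i + 2) - v) + ω * emb n D (i + 1) := by
      rw [hh i hi]
      ring
    have t1 : ω * (emb n x (i + 2) - v) ≤ Θ ^ (n - 1 + i) * (2 * Y) :=
      (le_abs_self _).trans (by rw [abs_mul]; gcongr)
    have t2 : ω * emb n D (i + 1) ≤ Θ ^ (n - 1 + i) * Y :=
      (le_abs_self _).trans (by rw [abs_mul]; gcongr)
    have t3 : -((emb n x (i + 2) - v) * fderiv ℝ (vpow n l (i + 1)) x h) ≤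
        2 * Y * (C * Θ ^ (n - 1 + i)) :=
      (neg_le_abs _).trans (by rw [abs_mul]; gcongr)
    rw [e, hωv]
    linarith
  rw [Finset.sum_range_succ, Finset.sum_range_succ (fun j => ν j ^ M)]
  rw [Finset.sum_range_succ (fun j => ν j ^ M)] at hmix
  rw [Finset.sum_range_succ (fun j => δ j ^ M)] at hmix ⊢
  set S := ∑ j ∈ Finset.range i, ν j ^ M
  set T := ∑ j ∈ Finset.range (i + 1), δ j ^ M
  have hT : 0 ≤ T := Finset.sum_nonneg fun j _ => pow_nonneg (hδ0 j) _
  have p1 : 0 ≤ ν (i + 1) ^ M := pow_nonneg (hν0 _) _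
  have p2 : 0 ≤ δ (i + 1) ^ M := pow_nonneg (hδ0 _) _
  have p3 : K * T ≤ |K| * (ν (i + 1) ^ M + (T + δ (i + 1) ^ M)) := by
    refine (mul_le_mul_of_nonneg_right (le_abs_self K) hT).trans ?_
    gcongr
    linarith
  rw [hli] at hnew
  linarith

theorem exists_stageBound (hn : 2 ≤ n) (i : ℕ) (hi : i < n) :
    ∃ (l : ℕ → ℝ) (c K : ℝ), (∀ j, 0 < l j) ∧ 0 < c ∧ 0 < K ∧ StageBound n l i c K := by
  induction i with
  | zero =>
    refine ⟨fun _ => 1, 1, 1, fun _ => one_pos, one_pos, one_pos, fun x h D _ => ?_⟩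
    have h1 := pow_nonneg (omSize_nonneg (l := fun _ => 1) (x := x) 0) (2 * n - 2)
    have h2 := pow_nonneg (distSize_nonneg (D := D) 0) (2 * n - 2)
    simp only [Finset.sum_range_zero, zero_add, Finset.sum_range_one]
    linarith
  | succ i ih =>
    obtain ⟨l, c, K, hl, hc, hK, hb⟩ := ih (by omega)
    have hl' : ∀ j, 0 < Function.update l (i + 1) (K + c) j := by
      intro j
      rcases eq_or_ne j (i + 1) with rfl | hj
      · simpa using by linarith
      · simpa [hj] using hl j
    have hb' : StageBound n (Function.update l (i + 1) (K + c)) i c K :=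
      hb.congr fun j hj => (Function.update_of_ne (by omega) _ _).symm
    obtain ⟨K', hK', hb''⟩ := hb'.succ hn hl' hi hc (Function.update_self _ _ _)
    exact ⟨_, c / 2, K', hl', by positivity, hK', hb''⟩

end Lyapunov

/-! ### The main inequality -/

theorem emb_succ {n : ℕ} (x : Fin n → ℝ) {j : ℕ} (hj : j < n) : emb n x (j + 1) = x ⟨j, hj⟩ :=
  dif_pos (by omega : 1 ≤ j + 1 ∧ j + 1 ≤ n)

theorem Jmat_mulVec {n : ℕ} (x : Fin n → ℝ) (j : Fin n) :
    (Jmat n *ᵥ x) j = emb n x (j + 2) := by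
  simp only [Matrix.mulVec, dotProduct, Jmat, Matrix.of_apply, ite_mul, one_mul, zero_mul]
  by_cases hj : (j : ℕ) + 1 < n
  · rw [Finset.sum_eq_single (⟨j + 1, hj⟩ : Fin n), if_pos rfl, emb_succ x hj]
    · intro b _ hb
      rw [if_neg fun h => hb (Fin.ext h.symm)]
    · simp
  · rw [Finset.sum_eq_zero, emb, dif_neg (by omega)]
    intro b _
    rw [if_neg (by omega)]

theorem dotProduct_eVec_self {n : ℕ} (D : Fin (n + 1) → ℝ) :
    D ⬝ᵥ eVec (n + 1) (n + 1) = D (Fin.last n) := by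
  rw [dotProduct, Finset.sum_eq_single (Fin.last n)]
  · simp [eVec]
  · intro b _ hb
    have : (b : ℕ) ≠ n := fun h => hb (Fin.ext h)
    simp [eVec, this]
  · simp

theorem mul_eq_abs_of_eq_sign {w s : ℝ} (hs : w ≠ 0 → s = Real.sign w) : w * s = |w| := by
  rcases lt_trichotomy w 0 with hw | rfl | hw
  · rw [hs hw.ne, Real.sign_of_neg hw, abs_of_neg hw]
    ring
  · simp
  · rw [hs hw.ne', Real.sign_of_pos hw, abs_of_pos hw]
    ring

theorem sum_distSize_pow {n : ℕ} (hn : 2 ≤ n) (D : Fin n → ℝ) :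
    ∑ j ∈ Finset.range n, distSize n D j ^ (2 * n - 2) =
      ∑ i : Fin n, (if (i : ℕ) + 1 < n then |D i| ^ (2 * pe n 2 / pe n ((i : ℕ) + 2)) else 0) := by
  obtain ⟨p, rfl⟩ : ∃ p, n = p + 1 := ⟨n - 1, by omega⟩
  have h0 : distSize (p + 1) D 0 = 0 := by
    have : ((p + 1 - 0 : ℕ) : ℝ)⁻¹ ≠ 0 := by positivity
    rw [distSize, show emb (p + 1) D 0 = 0 from dif_neg (by omega), abs_zero,
      Real.zero_rpow this]
  rw [Finset.sum_range_succ', h0, zero_pow (by omega), add_zero, Fin.sum_univ_castSucc]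
  simp only [Fin.val_castSucc, Fin.val_last, lt_self_iff_false, if_false, add_zero]
  rw [Finset.sum_range]
  refine Finset.sum_congr rfl fun i _ => ?_
  have hi := i.isLt
  have hp : (p : ℝ) + 1 ≠ 0 := by positivity
  have hd : (0 : ℝ) < p - i := by
    have : (i : ℝ) < p := by exact_mod_cast hi
    linarith
  rw [if_pos (by omega), distSize, emb_succ D (by omega), ← Real.rpow_natCast,
    ← Real.rpow_mul (abs_nonneg _)]
  congr 1
  rw [show p + 1 - ((i : ℕ) + 1) = p - i by omega, show 2 * (p + 1) - 2 = 2 * p by omega,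
    Nat.cast_sub hi.le, pe, pe]
  have e : (1 : ℝ) - (((i : ℕ) + 2 : ℕ) - 1 : ℝ) / ((p + 1 : ℕ) : ℝ) = (p - i) / (p + 1) := by
    push_cast
    field_simp
    ring
  rw [e]
  push_cast
  field_simp
  ring

theorem be_one_zero : be 1 0 = 0 := by
  norm_num [be, pe]

theorem Vn_one (l : ℕ → ℝ) (x : Fin 1 → ℝ) : Vn 1 l x = |x 0| := by
  have h : emb 1 x 1 = x 0 := emb_succ x one_pos
  simp [Vn, Wfb, vfb, be_one_zero, h]

theorem omn_one (l : ℕ → ℝ) (x : Fin 1 → ℝ) : omn 1 l x = Real.sign (x 0) := by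
  have h : emb 1 x 1 = x 0 := emb_succ x one_pos
  simp [omn, omfb, vfb, be_one_zero, h, sgnPow]

theorem contDiffOn_Vn_one (l : ℕ → ℝ) : ContDiffOn ℝ 1 (Vn 1 l) {(0 : Fin 1 → ℝ)}ᶜ := by
  rw [funext (Vn_one l)]
  intro x hx
  have hx0 : x 0 ≠ 0 := fun h => hx (funext fun i => by rw [Subsingleton.elim i 0, h]; rfl)
  exact ((contDiffAt_abs hx0).comp x (contDiff_apply ℝ ℝ 0).contDiffAt).contDiffWithinAt

theorem fderiv_Vn_one (l : ℕ → ℝ) {x : Fin 1 → ℝ} (hx : x 0 ≠ 0) (h : Fin 1 → ℝ) :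
    fderiv ℝ (Vn 1 l) x h = Real.sign (x 0) * h 0 := by
  have hproj : HasFDerivAt (fun y : Fin 1 → ℝ => y 0)
      (ContinuousLinearMap.proj (R := ℝ) (φ := fun _ : Fin 1 => ℝ) 0) x := hasFDerivAt_apply 0 x
  rw [show Vn 1 l = (fun t : ℝ => |t|) ∘ fun y : Fin 1 → ℝ => y 0 from funext (Vn_one l)]
  rcases hx.lt_or_gt with hx | hx
  · rw [((hasDerivAt_abs_neg hx).comp_hasFDerivAt x hproj).fderiv, Real.sign_of_neg hx]
    simp
  · rw [((hasDerivAt_abs_pos hx).comp_hasFDerivAt x hproj).fderiv, Real.sign_of_pos hx]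
    simp

theorem lyapunov_inequality_of_two_le {n : ℕ} (hn : 2 ≤ n) :
    ∃ (l : ℕ → ℝ) (C₁ C₂ : ℝ), (∀ i, 0 < l i) ∧ 0 < C₁ ∧ 0 < C₂ ∧
      ∀ x : Fin n → ℝ, ∀ u : ℝ, ∀ D : Fin n → ℝ, D ⬝ᵥ eVec n n = 0 →
        ∀ s : ℝ, (omn n l x ≠ 0 → s = Real.sign (omn n l x)) →
          fderiv ℝ (Vn n l) x ((Jmat n) *ᵥ x + u • eVec n n + D) ≤
            -C₁ * Vn n l x ^ al n + omn n l x * (u + l n * s) +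
              C₂ * ∑ i : Fin n,
                (if (i : ℕ) + 1 < n then |D i| ^ (2 * pe n 2 / pe n ((i : ℕ) + 2))
                 else 0) := by
  obtain ⟨p, rfl⟩ : ∃ p, n = p + 1 := ⟨n - 1, by omega⟩
  obtain ⟨l₀, c, K, hl₀, hc, hK, hb₀⟩ := exists_stageBound hn p (by omega)
  set l := Function.update l₀ (p + 1) (K + c) with hldef
  have hl : ∀ j, 0 < l j := by
    intro j
    rcases eq_or_ne j (p + 1) with rfl | hj
    · simpa [hldef] using by linarith
    · simpa [hldef, hj] using hl₀ j
  have hln : l (p + 1) = K + c := Function.update_self _ _ _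
  have hb : StageBound (p + 1) l p c K :=
    hb₀.congr fun j hj => (Function.update_of_ne (by omega) _ _).symm
  obtain ⟨C, hC, hV⟩ := exists_Vn_rpow_le hn l
  refine ⟨l, c / C, K, hl, by positivity, hK, fun x u D hD s hs => ?_⟩
  rw [dotProduct_eVec_self] at hD
  set h := (Jmat (p + 1)) *ᵥ x + u • eVec (p + 1) (p + 1) + D with hh
  have hlast : emb (p + 1) h (p + 1) = u := by
    rw [emb_succ h (by omega)]
    change (Jmat (p + 1) *ᵥ x) (Fin.last p) + u * eVec (p + 1) (p + 1) (Fin.last p) +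
      D (Fin.last p) = u
    rw [hD, Jmat_mulVec, emb, dif_neg (by simp)]
    simp [eVec]
  have hchain : ∀ j, j + 1 < p + 1 →
      emb (p + 1) h (j + 1) = emb (p + 1) x (j + 2) + emb (p + 1) D (j + 1) := by
    intro j hj
    rw [emb_succ h (by omega), emb_succ D (by omega)]
    change (Jmat (p + 1) *ᵥ x) ⟨j, _⟩ + u * eVec (p + 1) (p + 1) ⟨j, _⟩ + D ⟨j, _⟩ = _
    have : j ≠ p := by omega
    rw [Jmat_mulVec]
    simp [eVec, this]
  have hstage := hb x h D hchain
  have hder : fderiv ℝ (Vn (p + 1) l) x h = ∑ j ∈ Finset.range p,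
      (omfb (p + 1) l (j + 1) (emb (p + 1) x) * emb (p + 1) h (j + 1) -
        (emb (p + 1) x (j + 2) - vfb (p + 1) l (j + 1) (emb (p + 1) x)) *
          fderiv ℝ (vpow (p + 1) l (j + 1)) x h) + omn (p + 1) l x * u := by
    rw [fderiv_Vn hn hl, Finset.sum_sub_distrib, Finset.sum_sub_distrib, Finset.sum_range_succ,
      Finset.sum_range_succ' (fun i => (emb (p + 1) x (i + 1) - vfb (p + 1) l i (emb (p + 1) x)) *
        fderiv ℝ (vpow (p + 1) l i) x h), vpow_zero, hlast]
    simp only [fderiv_fun_const, Pi.zero_apply, _root_.zero_apply, mul_zero, add_zero,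
      omn]
    ring
  have hω : |omn (p + 1) l x| = omSize (p + 1) l x p ^ (2 * (p + 1) - 2) := by
    rw [show 2 * (p + 1) - 2 = p + 1 - 1 + p by omega, omSize_pow hn]
    rfl
  have hV' : c / C * Vn (p + 1) l x ^ al (p + 1) ≤
      c * ∑ i ∈ Finset.range (p + 1), omSize (p + 1) l x i ^ (2 * (p + 1) - 2) := by
    refine (mul_le_mul_of_nonneg_left (hV x) (by positivity)).trans_eq ?_
    field_simp
  rw [← sum_distSize_pow hn, hder, mul_add, mul_left_comm, mul_eq_abs_of_eq_sign hs, hω, hln]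
  rw [Finset.sum_range_succ] at hV'
  linarith

/-- there exist positive gains `l_1,…,l_n` and `C₁, C₂ > 0` such that
`V_n` is `C¹` away from `0` and for every `x ≠ 0`, `u ∈ ℝ`, mismatched disturbance
`D` (`Dᵀe_n = 0`) and `s ∈ [-1,1]` with `s = sign(ω_n(x))` whenever `ω_n(x) ≠ 0`,
`∇V_n(x)·(J_n x + e_n u + D) ≤ -C₁ V_n(x)^α + ω_n(x)(u + l_n s) + C₂ Σ_{i=1}^{n-1} |d_i|^{2p₂/p_{i+1}}`. -/
theorem key_Lyapunov_inequality_with_mismatched_disturbance (n : ℕ) (hn : 0 < n) :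
    ∃ (l : ℕ → ℝ) (C₁ C₂ : ℝ), (∀ i, 0 < l i) ∧ 0 < C₁ ∧ 0 < C₂ ∧
      ContDiffOn ℝ 1 (Vn n l) {(0 : Fin n → ℝ)}ᶜ ∧
      ∀ x : Fin n → ℝ, x ≠ 0 → ∀ u : ℝ, ∀ D : Fin n → ℝ, D ⬝ᵥ eVec n n = 0 →
        ∀ s : ℝ, s ∈ Set.Icc (-1 : ℝ) 1 →
          (omn n l x ≠ 0 → s = Real.sign (omn n l x)) →
          fderiv ℝ (Vn n l) x ((Jmat n) *ᵥ x + u • eVec n n + D) ≤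
            -C₁ * Vn n l x ^ al n + omn n l x * (u + l n * s) +
              C₂ * ∑ i : Fin n,
                (if (i : ℕ) + 1 < n then |D i| ^ (2 * pe n 2 / pe n ((i : ℕ) + 2))
                 else 0) := by
  rcases (by omega : n = 1 ∨ 2 ≤ n) with rfl | h2
  · refine ⟨fun _ => 1, 1, 1, fun _ => one_pos, one_pos, one_pos, contDiffOn_Vn_one _, ?_⟩
    intro x hx u D hD s _ hs
    have hx0 : x 0 ≠ 0 := fun h => hx (funext fun i => by rw [Subsingleton.elim i 0, h]; rfl)
    have hα : al 1 = 0 := by norm_num [al]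
    have hsign : |Real.sign (x 0)| = 1 := by
      rcases Real.sign_apply_eq_of_ne_zero _ hx0 with h | h <;> simp [h]
    have hJ : (Jmat 1 *ᵥ x) 0 = 0 := (Jmat_mulVec x 0).trans (dif_neg (by simp))
    have hD0 : D 0 = 0 := (dotProduct_eVec_self D).symm.trans hD
    rw [fderiv_Vn_one _ hx0, hα, Real.rpow_zero, mul_add, one_mul, mul_eq_abs_of_eq_sign hs,
      omn_one, hsign]
    simp [hJ, hD0, eVec]
  · obtain ⟨l, C₁, C₂, hl, hC₁, hC₂, h⟩ := lyapunov_inequality_of_two_le h2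
    exact ⟨l, C₁, C₂, hl, hC₁, hC₂, (contDiff_Vn h2 hl).contDiffOn,
      fun x _ u D hD s _ hs => h x u D hD s hs⟩
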